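/- arXiv:1711.03456 — 6 statements merged into one kernel-verified Lean document; each statement's English description precedes it below -/
import Mathlib

section
/- Let (X₁, Y₁) and (X₂, Y₂) be pairs of real-valued random variables such that the pair (X₁, Y₁) is independent of the pair (X₂, Y₂). Then the Kolmogorov distance satisfies d(X₁+X₂, Y₁+Y₂) ≤ d(X₁, Y₁) + d(X₂, Y₂). -/
open MeasureTheory ProbabilityTheory

/-- The Kolmogorov distance between two real-valued random variables:
the supremum over `s : ℝ` of `|P(X ≤ s) - P(Y ≤ s)|`. -/
noncomputable def kolmogorovDist {Ω : Type*} [MeasurableSpace Ω] (μ : Measure Ω)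
    (X Y : Ω → ℝ) : ℝ :=
  ⨆ s : ℝ, |(μ {ω | X ω ≤ s}).toReal - (μ {ω | Y ω ≤ s}).toReal|

/-- The difference of the distribution functions at a point is at most the Kolmogorov distance. -/
lemma abs_sub_le_kolmogorovDist {Ω : Type*} [MeasurableSpace Ω] (μ : Measure Ω)
    [IsProbabilityMeasure μ] (X Y : Ω → ℝ) (s : ℝ) :
    |(μ {ω | X ω ≤ s}).toReal - (μ {ω | Y ω ≤ s}).toReal| ≤ kolmogorovDist μ X Y := by
  refine le_ciSup (f := fun s : ℝ => |(μ {ω | X ω ≤ s}).toReal - (μ {ω | Y ω ≤ s}).toReal|)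
    ⟨1, ?_⟩ s
  rintro _ ⟨t, rfl⟩
  exact abs_sub_le_of_nonneg_of_le ENNReal.toReal_nonneg measureReal_le_one
    ENNReal.toReal_nonneg measureReal_le_one

lemma measurable_toReal_measure_le_sub {Ω : Type*} [MeasurableSpace Ω] (μ : Measure Ω)
    [IsProbabilityMeasure μ] (X : Ω → ℝ) (s : ℝ) :
    Measurable fun z : ℝ => (μ {ω | X ω ≤ s - z}).toReal := by
  have h : Monotone fun t : ℝ => (μ {ω | X ω ≤ t}).toReal := fun a b hab =>
    measureReal_mono fun ω (hω : X ω ≤ a) => hω.trans hab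
  exact h.measurable.comp (measurable_const.sub measurable_id)

/-- The distribution function of a sum of independent random variables, as an integral over the
law of one summand. -/
lemma ProbabilityTheory.IndepFun.toReal_measure_add_le_eq_integral {Ω : Type*} [MeasurableSpace Ω]
    {μ : Measure Ω} [IsProbabilityMeasure μ] {X Z : Ω → ℝ} (hX : Measurable X)
    (hZ : Measurable Z) (h : IndepFun X Z μ) (s : ℝ) :
    (μ {ω | X ω + Z ω ≤ s}).toReal = ∫ z, (μ {ω | X ω ≤ s - z}).toReal ∂(μ.map Z) := by
  have := Measure.isProbabilityMeasure_map (μ := μ) hX.aemeasurable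
  have := Measure.isProbabilityMeasure_map (μ := μ) hZ.aemeasurable
  have hS : MeasurableSet {p : ℝ × ℝ | p.1 + p.2 ≤ s} :=
    measurableSet_le (measurable_fst.add measurable_snd) measurable_const
  have hsection (z : ℝ) : (μ.map X) ((fun x => (x, z)) ⁻¹' {p : ℝ × ℝ | p.1 + p.2 ≤ s}) =
      μ {ω | X ω ≤ s - z} := by
    rw [Measure.map_apply hX (measurable_prodMk_right hS)]
    congr 1
    ext ω
    simp [le_sub_iff_add_le]
  have hsum : μ {ω | X ω + Z ω ≤ s} = ∫⁻ z, μ {ω | X ω ≤ s - z} ∂(μ.map Z) := by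
    rw [show {ω | X ω + Z ω ≤ s} = (fun ω => (X ω, Z ω)) ⁻¹' {p : ℝ × ℝ | p.1 + p.2 ≤ s} from rfl,
      ← Measure.map_apply (hX.prodMk hZ) hS,
      (indepFun_iff_map_prod_eq_prod_map_map hX.aemeasurable hZ.aemeasurable).mp h,
      Measure.prod_apply_symm hS]
    simp_rw [hsection]
  rw [hsum, integral_toReal]
  · simp_rw [← hsection]
    exact (measurable_measure_prodMk_right hS).aemeasurable
  · exact ae_of_all _ fun z => measure_lt_top _ _

/-- Adding an independent random variable does not increase the Kolmogorov distance. -/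
lemma abs_sub_add_le_kolmogorovDist {Ω : Type*} [MeasurableSpace Ω] (μ : Measure Ω)
    [IsProbabilityMeasure μ] {X Y Z : Ω → ℝ} (hX : Measurable X) (hY : Measurable Y)
    (hZ : Measurable Z) (hXZ : IndepFun X Z μ) (hYZ : IndepFun Y Z μ) (s : ℝ) :
    |(μ {ω | X ω + Z ω ≤ s}).toReal - (μ {ω | Y ω + Z ω ≤ s}).toReal| ≤
      kolmogorovDist μ X Y := by
  have := Measure.isProbabilityMeasure_map (μ := μ) hZ.aemeasurable
  have hint (W : Ω → ℝ) : Integrable (fun z => (μ {ω | W ω ≤ s - z}).toReal) (μ.map Z) :=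
    .of_bound (measurable_toReal_measure_le_sub μ W s).aestronglyMeasurable 1 <|
      ae_of_all _ fun z => by
        rw [Real.norm_of_nonneg ENNReal.toReal_nonneg]
        exact measureReal_le_one
  rw [hXZ.toReal_measure_add_le_eq_integral hX hZ, hYZ.toReal_measure_add_le_eq_integral hY hZ,
    ← integral_sub (hint X) (hint Y), ← Real.norm_eq_abs]
  have hbound : ∀ᵐ z ∂(μ.map Z), ‖(μ {ω | X ω ≤ s - z}).toReal - (μ {ω | Y ω ≤ s - z}).toReal‖ ≤
      kolmogorovDist μ X Y :=
    ae_of_all _ fun z => abs_sub_le_kolmogorovDist μ X Y (s - z)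
  simpa using norm_integral_le_of_norm_le_const hbound

/-- If the pair `(X₁, Y₁)` is independent of the pair `(X₂, Y₂)`, then
`d(X₁ + X₂, Y₁ + Y₂) ≤ d(X₁, Y₁) + d(X₂, Y₂)` for the Kolmogorov distance. -/
theorem kolmogorovDist_add_le_of_indep_pairs {Ω : Type*} [MeasurableSpace Ω]
    (μ : Measure Ω) [IsProbabilityMeasure μ]
    (X₁ Y₁ X₂ Y₂ : Ω → ℝ)
    (hX₁ : Measurable X₁) (hY₁ : Measurable Y₁)
    (hX₂ : Measurable X₂) (hY₂ : Measurable Y₂)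
    (hindep : IndepFun (fun ω => (X₁ ω, Y₁ ω)) (fun ω => (X₂ ω, Y₂ ω)) μ) :
    kolmogorovDist μ (fun ω => X₁ ω + X₂ ω) (fun ω => Y₁ ω + Y₂ ω) ≤
      kolmogorovDist μ X₁ Y₁ + kolmogorovDist μ X₂ Y₂ := by
  have hXX : IndepFun X₁ X₂ μ := hindep.comp measurable_fst measurable_fst
  have hYX : IndepFun Y₁ X₂ μ := hindep.comp measurable_snd measurable_fst
  have hYY : IndepFun Y₁ Y₂ μ := hindep.comp measurable_snd measurable_snd
  refine ciSup_le fun s => ?_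
  have h₁ := abs_sub_add_le_kolmogorovDist μ hX₁ hY₁ hX₂ hXX hYX s
  have h₂ := abs_sub_add_le_kolmogorovDist μ hX₂ hY₂ hY₁ hYX.symm hYY.symm s
  simp only [add_comm _ (Y₁ _)] at h₂
  exact (abs_sub_le _ _ _).trans (add_le_add h₁ h₂)
end

section
/- Let L : (0,∞) → (0,∞) be slowly varying (for every λ > 0, L(λx)/L(x) → 1 as x → ∞), and suppose L(x) → ∞ as x → ∞. Then for every natural number n ≥ 1, the series ∑_{k=0}^∞ |1 − L(2^k n)/L(2^{k+1} n)| diverges to infinity. -/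
open Filter

/-- If a positive sequence tends to infinity, then `∑ₖ |1 − aₖ / aₖ₊₁|` diverges. -/
theorem tendsto_sum_abs_one_sub_div_atTop {a : ℕ → ℝ} (hpos : ∀ k, 0 < a k)
    (htop : Tendsto a atTop atTop) :
    Tendsto (fun K : ℕ => ∑ k ∈ Finset.range K, |1 - a k / a (k + 1)|) atTop atTop := by
  refine (not_summable_iff_tendsto_nat_atTop_of_nonneg fun k => abs_nonneg _).1 fun hsum => ?_
  have habs : Summable fun k => a k / a (k + 1) - 1 :=
    Summable.of_abs (by simpa only [abs_sub_comm] using hsum)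
  have hlog : Summable fun k => Real.log (a k) - Real.log (a (k + 1)) := by
    refine (Real.summable_log_one_add_of_summable habs).congr fun k => ?_
    rw [add_sub_cancel, Real.log_div (hpos k).ne' (hpos (k + 1)).ne']
  have hlim := hlog.hasSum.tendsto_sum_nat
  simp only [Finset.sum_range_sub'] at hlim
  have hbot : Tendsto (fun K => Real.log (a 0) - Real.log (a K)) atTop atBot :=
    tendsto_atBot_add_const_left _ _
      (tendsto_neg_atTop_atBot.comp (Real.tendsto_log_atTop.comp htop))
  exact not_tendsto_nhds_of_tendsto_atBot hbot _ hlim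

/-- If `L : (0,∞) → (0,∞)` is slowly varying and `L(x) → ∞` as `x → ∞`, then for
every `n ≥ 1` the series `∑ₖ |1 − L(2^k n)/L(2^{k+1} n)|` diverges to infinity. -/
theorem slowly_varying_series_diverges (L : ℝ → ℝ)
    (hLpos : ∀ x > (0 : ℝ), 0 < L x)
    (hslow : ∀ l > (0 : ℝ), Tendsto (fun x => L (l * x) / L x) atTop (nhds 1))
    (hLtop : Tendsto L atTop atTop) :
    ∀ n : ℕ, 1 ≤ n →
      Tendsto (fun K : ℕ =>
          ∑ k ∈ Finset.range K, |1 - L ((2 : ℝ) ^ k * n) / L ((2 : ℝ) ^ (k + 1) * n)|)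
        atTop atTop := by
  intro n hn
  have hn' : (0 : ℝ) < n := by exact_mod_cast hn
  exact tendsto_sum_abs_one_sub_div_atTop (a := fun k => L ((2 : ℝ) ^ k * n))
    (fun k => hLpos _ (by positivity))
    (hLtop.comp ((tendsto_pow_atTop_atTop_of_one_lt one_lt_two).atTop_mul_const hn'))
end

section
/- Let L : (0,∞) → (0,∞) be slowly varying (for every λ > 0, L(λx)/L(x) → 1 as x → ∞), and suppose L(x) → ∞ as x → ∞. Then for every ε > 0, limsup_{n→∞} (log n)^{1+ε} |1 − L(n)/L(2n)| = ∞, where the limsup is over natural numbers n. -/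
open Filter

/-- A real sequence whose increments are eventually dominated by a nonnegative summable sequence
does not tend to infinity. -/
theorem not_tendsto_atTop_of_sub_le_summable {b c : ℕ → ℝ} (hc : Summable c) (hc0 : ∀ k, 0 ≤ c k)
    (h : ∀ᶠ k in atTop, b (k + 1) - b k ≤ c k) : ¬ Tendsto b atTop atTop := by
  intro hb
  obtain ⟨K, hK⟩ := eventually_atTop.1 h
  have hpartial : ∀ k ≥ K, b k ≤ b K + ∑ i ∈ Finset.range k, c i := by
    intro k hk
    induction k, hk using Nat.le_induction with
    | base => linarith [Finset.sum_nonneg fun i (_ : i ∈ Finset.range K) => hc0 i]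
    | succ k hk ih =>
      rw [Finset.sum_range_succ]
      linarith [hK k hk]
  obtain ⟨k, hk, hkK⟩ :=
    ((hb.eventually_gt_atTop (b K + ∑' i, c i)).and (eventually_ge_atTop K)).exists
  linarith [hpartial k hkK, hc.sum_le_tsum (Finset.range k) fun i _ => hc0 i]

/-- If `y / x ≤ 2`, then `log y - log x` is controlled by the relative increment `1 - x / y`. -/
theorem Real.log_sub_log_le_two_mul_abs {x y : ℝ} (hx : 0 < x) (hy : 0 < y) (h : y / x ≤ 2) :
    Real.log y - Real.log x ≤ 2 * |1 - x / y| := by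
  rw [← Real.log_div hy.ne' hx.ne']
  calc Real.log (y / x) ≤ y / x - 1 := Real.log_le_sub_one_of_pos (div_pos hy hx)
    _ = y / x * (1 - x / y) := by field_simp
    _ ≤ y / x * |1 - x / y| := by gcongr; exact le_abs_self _
    _ ≤ 2 * |1 - x / y| := by gcongr

/-- If `L : (0,∞) → (0,∞)` is slowly varying and `L(x) → ∞` as `x → ∞`, then for
every `ε > 0`, `limsup_{n→∞} (log n)^{1+ε} |1 − L(n)/L(2n)| = ∞` over naturals `n`. -/
theorem slowly_varying_tendsto_top_limsup (L : ℝ → ℝ)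
    (hLpos : ∀ x > (0 : ℝ), 0 < L x)
    (hslow : ∀ l > (0 : ℝ), Tendsto (fun x => L (l * x) / L x) atTop (nhds 1))
    (hLtop : Tendsto L atTop atTop) :
    ∀ ε > (0 : ℝ),
      limsup (fun n : ℕ =>
          ((Real.log n ^ (1 + ε) * |1 - L n / L (2 * n)| : ℝ) : EReal)) atTop = ⊤ := by
  intro ε hε
  by_contra hne
  obtain ⟨C, hC, -⟩ := EReal.lt_iff_exists_real_btwn.1 (lt_top_iff_ne_top.2 hne)
  have hbound := eventually_lt_of_limsup_lt hC
  have hpow : Tendsto (fun k : ℕ => 2 ^ k) atTop (atTop : Filter ℕ) :=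
    tendsto_pow_atTop_atTop_of_one_lt one_lt_two
  have hpowR : Tendsto (fun k : ℕ => (2 : ℝ) ^ k) atTop atTop :=
    tendsto_pow_atTop_atTop_of_one_lt one_lt_two
  have hlog2 : 0 < Real.log 2 := Real.log_pos one_lt_two
  refine not_tendsto_atTop_of_sub_le_summable (b := fun k => Real.log (L (2 ^ k)))
    (c := fun k => 2 * |C| / Real.log 2 ^ (1 + ε) * (1 / (k : ℝ) ^ (1 + ε))) ?_ ?_ ?_
    (Real.tendsto_log_atTop.comp (hLtop.comp hpowR))
  · exact (Real.summable_one_div_nat_rpow.2 (by linarith)).mul_left _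
  · intro k
    positivity
  · have hratio := hpowR.eventually ((hslow 2 two_pos).eventually_le_const one_lt_two)
    filter_upwards [hratio, hpow.eventually hbound, eventually_gt_atTop 0] with k hk hkC hk0
    rw [EReal.coe_lt_coe_iff] at hkC
    push_cast at hkC
    have hkpos : (0 : ℝ) < k := by exact_mod_cast hk0
    rw [Real.log_pow, Real.mul_rpow hkpos.le hlog2.le] at hkC
    rw [pow_succ']
    refine (Real.log_sub_log_le_two_mul_abs (hLpos _ (by positivity)) (hLpos _ (by positivity))
      hk).trans ?_
    have hA : 0 < (k : ℝ) ^ (1 + ε) := by positivity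
    have hB : 0 < Real.log 2 ^ (1 + ε) := by positivity
    rw [div_mul_div_comm, mul_one, le_div_iff₀ (by positivity)]
    linarith [le_abs_self C]
end

section
/- Let L : (0,∞) → (0,∞) be slowly varying (for every λ > 0, L(λx)/L(x) → 1 as x → ∞), and suppose L(x) → 0 as x → ∞. Then for every ε > 0, limsup_{n→∞} (log n)^{1+ε} |1 − L(n)/L(2n)| = ∞, where the limsup is over natural numbers n. -/
open Filter

/-- A positive sequence whose consecutive ratios are summably close to `1` cannot tend to `0`. -/
theorem not_tendsto_zero_of_summable_ratio {a : ℕ → ℝ} (ha : ∀ n, 0 < a n)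
    (hs : Summable fun n => |1 - a n / a (n + 1)|) : ¬ Tendsto a atTop (nhds 0) := by
  intro h0
  set e : ℕ → ℝ := fun n => |1 - a n / a (n + 1)| with he
  have hstep : ∀ n, a n ≤ Real.exp (e n) * a (n + 1) := fun n => by
    have h1 : a n / a (n + 1) ≤ Real.exp (e n) := by
      have h2 := neg_abs_le (1 - a n / a (n + 1))
      have h3 := Real.add_one_le_exp (e n)
      simp only [he] at h3 ⊢
      linarith
    exact (div_le_iff₀ (ha _)).1 h1
  have hmono : ∀ n, a 0 ≤ Real.exp (∑ k ∈ Finset.range n, e k) * a n := fun n => by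
    induction n with
    | zero => simp
    | succ n ih =>
      rw [Finset.sum_range_succ, Real.exp_add, mul_assoc]
      exact ih.trans (mul_le_mul_of_nonneg_left (hstep n) (Real.exp_pos _).le)
  have hbound : ∀ n, a 0 ≤ Real.exp (∑' k, e k) * a n := fun n =>
    (hmono n).trans <| mul_le_mul_of_nonneg_right
      (Real.exp_le_exp.2 (hs.sum_le_tsum _ fun _ _ => abs_nonneg _)) (ha n).le
  have hlim := ge_of_tendsto' (h0.const_mul (Real.exp (∑' k, e k))) hbound
  rw [mul_zero] at hlim
  exact (ha 0).not_ge hlim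

/-- If `L : (0,∞) → (0,∞)` is slowly varying and `L(x) → 0` as `x → ∞`, then for
every `ε > 0`, `limsup_{n→∞} (log n)^{1+ε} |1 − L(n)/L(2n)| = ∞` over naturals `n`. -/
theorem slowly_varying_tendsto_zero_limsup (L : ℝ → ℝ)
    (hLpos : ∀ x > (0 : ℝ), 0 < L x)
    (hslow : ∀ l > (0 : ℝ), Tendsto (fun x => L (l * x) / L x) atTop (nhds 1))
    (hLzero : Tendsto L atTop (nhds 0)) :
    ∀ ε > (0 : ℝ),
      limsup (fun n : ℕ =>
          ((Real.log n ^ (1 + ε) * |1 - L n / L (2 * n)| : ℝ) : EReal)) atTop = ⊤ := by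
  intro ε hε
  by_contra hne
  obtain ⟨C, hC, -⟩ := EReal.lt_iff_exists_real_btwn.1 (lt_top_iff_ne_top.2 hne)
  have hev := (tendsto_pow_atTop_atTop_of_one_lt (one_lt_two : (1 : ℕ) < 2)).eventually
    (eventually_lt_of_limsup_lt hC)
  refine not_tendsto_zero_of_summable_ratio (a := fun k : ℕ => L (2 ^ k))
    (fun k => hLpos _ (by positivity)) ?_
    (hLzero.comp (tendsto_pow_atTop_atTop_of_one_lt one_lt_two))
  have hsum : Summable fun k : ℕ => C / Real.log 2 ^ (1 + ε) * (1 / (k : ℝ) ^ (1 + ε)) :=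
    (Real.summable_one_div_nat_rpow.2 (by linarith)).mul_left _
  refine hsum.of_norm_bounded_eventually_nat ?_
  filter_upwards [hev, eventually_gt_atTop 0] with k hk hk0
  have hlog : 0 < Real.log 2 := Real.log_pos one_lt_two
  have hkpos : (0 : ℝ) < k := Nat.cast_pos.2 hk0
  rw [EReal.coe_lt_coe_iff] at hk
  push_cast at hk
  rw [Real.log_pow, Real.mul_rpow hkpos.le hlog.le, ← pow_succ'] at hk
  rw [Real.norm_eq_abs, abs_abs, div_mul_div_comm, mul_one, le_div_iff₀ (by positivity)]
  linarith
end

section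
/- Let L(n) = √(log n) for natural numbers n ≥ 2. Then lim_{n→∞} (log n) · |1 − L(n)/L(2n)| = lim_{n→∞} (log n) · (1 − √(log n / log(2n))) = (log 2)/2. -/
open Filter

lemma tendsto_div_add_const_atTop_nhds_one (c : ℝ) :
    Tendsto (fun x : ℝ => x / (x + c)) atTop (nhds 1) := by
  have h : Tendsto (fun x : ℝ => 1 - c / (x + c)) atTop (nhds (1 - 0)) :=
    tendsto_const_nhds.sub (tendsto_const_nhds.div_atTop
      (tendsto_atTop_add_const_right _ c tendsto_id))
  rw [sub_zero] at h
  refine h.congr' ?_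
  filter_upwards [eventually_gt_atTop (-c)] with x hx
  have : x + c ≠ 0 := by linarith
  field_simp
  ring

lemma tendsto_mul_one_sub_sqrt_div_add_const (c : ℝ) :
    Tendsto (fun x : ℝ => x * (1 - Real.sqrt (x / (x + c)))) atTop (nhds (c / 2)) := by
  have hr := tendsto_div_add_const_atTop_nhds_one c
  have h : Tendsto (fun x : ℝ => c * (x / (x + c)) / (1 + Real.sqrt (x / (x + c)))) atTop
      (nhds (c * 1 / (1 + Real.sqrt 1))) :=
    (hr.const_mul c).div (hr.sqrt.const_add 1) (by positivity)
  rw [Real.sqrt_one, mul_one, one_add_one_eq_two] at h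
  refine h.congr' ?_
  filter_upwards [eventually_gt_atTop (-c), eventually_gt_atTop 0] with x hx hx0
  have hxc : 0 < x + c := by linarith
  have hs : Real.sqrt (x / (x + c)) ^ 2 = x / (x + c) := Real.sq_sqrt (by positivity)
  have hc : c * (x / (x + c)) = x * (1 - x / (x + c)) := by
    field_simp
    ring
  rw [div_eq_iff (by positivity), hc]
  linear_combination x * hs

/-- For `L n = √(log n)`,
`lim_{n→∞} (log n)·|1 − L(n)/L(2n)| = lim_{n→∞} (log n)·(1 − √(log n / log (2n))) = (log 2)/2`. -/
theorem tendsto_log_mul_one_sub_sqrt_log_ratio :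
    Tendsto (fun n : ℕ =>
        Real.log n * |1 - Real.sqrt (Real.log n) / Real.sqrt (Real.log (2 * n))|)
      atTop (nhds (Real.log 2 / 2)) ∧
    Tendsto (fun n : ℕ =>
        Real.log n * (1 - Real.sqrt (Real.log n / Real.log (2 * n))))
      atTop (nhds (Real.log 2 / 2)) := by
  have h : Tendsto (fun n : ℕ =>
      Real.log n * (1 - Real.sqrt (Real.log n / Real.log (2 * n))))
      atTop (nhds (Real.log 2 / 2)) := by
    refine ((tendsto_mul_one_sub_sqrt_div_add_const (Real.log 2)).comp
      (Real.tendsto_log_atTop.comp tendsto_natCast_atTop_atTop)).congr' ?_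
    filter_upwards [eventually_gt_atTop 0] with n hn
    have hn' : (n : ℝ) ≠ 0 := by positivity
    simp only [Function.comp_apply]
    rw [Real.log_mul two_ne_zero hn', add_comm (Real.log 2)]
  refine ⟨h.congr' ?_, h⟩
  filter_upwards [eventually_gt_atTop 0] with n hn
  have hn' : (1 : ℝ) ≤ n := by exact_mod_cast hn
  have hlog : 0 ≤ Real.log n := Real.log_nonneg hn'
  have hle : Real.log n ≤ Real.log (2 * n) := Real.log_le_log (by linarith) (by linarith)
  rw [← Real.sqrt_div hlog, abs_of_nonneg]
  rw [sub_nonneg, Real.sqrt_le_one]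
  exact div_le_one_of_le₀ hle (hlog.trans hle)
end

section
/- Let h : [N, ∞) → (0, ∞) (for some N) satisfy h(x)² = x · log h(x) for all x and h(x) → ∞ as x → ∞. Write h(n) = (1 + c_n) √((n log n)/2). Then c_n is asymptotic to (log log n)/(2 log n) as n → ∞; that is, lim_{n→∞} c_n · (2 log n)/(log log n) = 1. -/
open Filter

/-- If `2 l = L + log l` along a filter and `l → ∞`, then `log l / L → 0` and
`log l / log L → 1`. -/
theorem tendsto_log_div_of_two_mul_eq_add_log {ι : Type*} {f : Filter ι} {l L : ι → ℝ}
    (hl : Tendsto l f atTop) (hlL : ∀ᶠ i in f, 2 * l i = L i + Real.log (l i)) :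
    Tendsto (fun i => Real.log (l i) / L i) f (nhds 0) ∧
      Tendsto (fun i => Real.log (l i) / Real.log (L i)) f (nhds 1) := by
  have hlog : Tendsto (fun i => Real.log (l i)) f atTop := Real.tendsto_log_atTop.comp hl
  have hsmall : Tendsto (fun i => Real.log (l i) / l i) f (nhds 0) :=
    Real.isLittleO_log_id_atTop.tendsto_div_nhds_zero.comp hl
  have hratio : Tendsto (fun i => L i / l i) f (nhds 2) := by
    have h2 : Tendsto (fun i => 2 - Real.log (l i) / l i) f (nhds 2) := by
      simpa using hsmall.const_sub 2
    refine h2.congr' ?_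
    filter_upwards [hlL, hl.eventually_gt_atTop 0] with i hi hpos
    rw [eq_sub_of_add_eq hi.symm]
    field_simp
  constructor
  · have hdiv := hsmall.div hratio two_ne_zero
    rw [zero_div] at hdiv
    refine hdiv.congr' ?_
    filter_upwards [hl.eventually_gt_atTop 0] with i hpos
    exact div_div_div_cancel_right₀ hpos.ne' _ _
  · have hlogratio := (hratio.log two_ne_zero).div_atTop hlog
    have hinv := (hlogratio.const_add 1).inv₀ (by norm_num)
    rw [add_zero, inv_one] at hinv
    refine hinv.congr' ?_
    filter_upwards [hl.eventually_gt_atTop 0, hlog.eventually_gt_atTop 0,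
      hratio.eventually_const_lt (show (0 : ℝ) < 2 by norm_num)] with i hpos hlogpos hrpos
    have hLpos : 0 < L i := (div_pos_iff_of_pos_right hpos).1 hrpos
    rw [Real.log_div hLpos.ne' hpos.ne', sub_div, div_self hlogpos.ne', add_sub_cancel, inv_div]

/-- If `h` satisfies `h(x)² = x log h(x)` (for `x ≥ N`) and `h(x) → ∞`, and we write
`h(n) = (1 + cₙ) √((n log n)/2)`, then `cₙ ∼ (log log n)/(2 log n)`, i.e.
`cₙ · (2 log n)/(log log n) → 1`. -/
theorem kuske_keller_scaling_asymptotics (h : ℝ → ℝ) (N : ℝ)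
    (hpos : ∀ x ≥ N, 0 < h x)
    (heq : ∀ x ≥ N, (h x) ^ 2 = x * Real.log (h x))
    (htop : Tendsto h atTop atTop)
    (c : ℕ → ℝ)
    (hc : ∀ᶠ n : ℕ in atTop, h n = (1 + c n) * Real.sqrt ((n * Real.log n) / 2)) :
    Tendsto (fun n : ℕ => c n * (2 * Real.log n) / Real.log (Real.log n))
      atTop (nhds 1) := by
  have hcast : Tendsto (fun n : ℕ => (n : ℝ)) atTop atTop := tendsto_natCast_atTop_atTop
  have hl : Tendsto (fun n : ℕ => Real.log (h n)) atTop atTop :=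
    Real.tendsto_log_atTop.comp (htop.comp hcast)
  have hL : Tendsto (fun n : ℕ => Real.log n) atTop atTop := Real.tendsto_log_atTop.comp hcast
  have hlL : ∀ᶠ n : ℕ in atTop,
      2 * Real.log (h n) = Real.log n + Real.log (Real.log (h n)) := by
    filter_upwards [hcast.eventually_ge_atTop N, hcast.eventually_gt_atTop 0,
      hl.eventually_gt_atTop 0] with n hn hn0 hl0
    rw [← Real.log_mul hn0.ne' hl0.ne', ← heq n hn, Real.log_pow]
    norm_num
  obtain ⟨hzero, hone⟩ := tendsto_log_div_of_two_mul_eq_add_log hl hlL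
  have hsq : ∀ᶠ n : ℕ in atTop, 0 < 1 + c n ∧
      (1 + c n) ^ 2 = 1 + Real.log (Real.log (h n)) / Real.log n := by
    filter_upwards [hcast.eventually_ge_atTop N, hcast.eventually_gt_atTop 0,
      hL.eventually_gt_atTop 0, hlL, hc] with n hn hn0 hL0 hn2 hcn
    have hp := hpos n hn
    have he := heq n hn
    refine ⟨pos_of_mul_pos_left (hcn ▸ hp) (Real.sqrt_nonneg _), ?_⟩
    have hs : h n ^ 2 = (1 + c n) ^ 2 * (n * Real.log n / 2) := by
      conv_lhs => rw [hcn]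
      rw [mul_pow, Real.sq_sqrt (by positivity)]
    have hmul : (1 + c n) ^ 2 * Real.log n = 2 * Real.log (h n) := by
      apply mul_left_cancel₀ hn0.ne'
      linarith
    rw [eq_comm, one_add_div hL0.ne', div_eq_iff hL0.ne', hmul, hn2]
  have hc1 : Tendsto (fun n => 1 + c n) atTop (nhds 1) := by
    have hsqrt := (hzero.const_add 1).sqrt
    rw [add_zero, Real.sqrt_one] at hsqrt
    refine hsqrt.congr' ?_
    filter_upwards [hsq] with n hn
    rw [← hn.2, Real.sqrt_sq hn.1.le]
  have hfactor : Tendsto (fun n => 2 / (1 + (1 + c n))) atTop (nhds 1) := by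
    have hdiv := (tendsto_const_nhds (x := (2 : ℝ))).div (hc1.const_add 1) (by norm_num)
    norm_num at hdiv
    exact hdiv
  have hprod := hfactor.mul hone
  rw [one_mul] at hprod
  refine hprod.congr' ?_
  filter_upwards [hsq, hL.eventually_gt_atTop 0] with n hn hL0
  have hne : 1 + (1 + c n) ≠ 0 := by linarith [hn.1]
  have hlog : Real.log (Real.log (h n)) = c n * (1 + (1 + c n)) * Real.log n := by
    rw [← div_eq_iff hL0.ne']
    linarith [hn.2]
  rw [hlog, ← mul_div_assoc]
  congr 1
  field_simp
end
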